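/- Almost-sure finiteness of the gentleness horizon. Let Γ, γ be moderately steep scales with parameters a > 0 and ε ∈ (0,1), let Q be a probability measure on {0,1}^{ℤ^d} satisfying the decay condition (smin) with constants b'', B'', assume p = sup_x Q(ω_x = 1) ≤ exp{−a/(1−ε)}, and assume condition (gag): 2·9^d·B''·θ_{k+1}^{2d}·exp{−b''Γ_{k+1}/20} ≤ exp{−a(1+ε)^{k+1}/(1−ε)} for all k ≥ 0. Then for Q-almost every ω, for every x ∈ ℤ^d the set {j ≥ 1 : there exists a j-gentle atom g ∈ 𝒢_j(ω) with sup-distance(x, Env(g)) ≤ θ_j} is finite, where Env(g) is the smallest coordinate parallelepiped containing g. -/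

import Mathlib

namespace Paper

open MeasureTheory

noncomputable section

/-- The lattice `ℤ^d`. -/
abbrev ZLat (d : ℕ) := Fin d → ℤ

/-- A disorder configuration `ω ∈ {0,1}^{ℤ^d}` (`true` = bad site). -/
abbrev DConf (d : ℕ) := ZLat d → Bool

/-- The `ℓ¹` distance on `ℤ^d`. -/
def D1 {d : ℕ} (x y : ZLat d) : ℕ := ∑ i, (x i - y i).natAbs

/-- The sup distance on `ℤ^d`. -/
def supD {d : ℕ} (x y : ZLat d) : ℕ := Finset.univ.sup fun i => (x i - y i).natAbs

/-- The `ℓ¹` ball `O_r(x)` of (real) radius `r` around `x`. -/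
def ball1 {d : ℕ} (x : ZLat d) (r : ℝ) : Set (ZLat d) := {y | (D1 x y : ℝ) ≤ r}

/-- The `ℓ¹` neighborhood `O_r(X)` of a set `X`. -/
def nbd1 {d : ℕ} (X : Set (ZLat d)) (r : ℝ) : Set (ZLat d) :=
  {y | ∃ x ∈ X, (D1 x y : ℝ) ≤ r}

/-- The σ-algebra `𝒜_Λ` generated by the coordinates in `Λ`. -/
def cylSigma {d : ℕ} (Λ : Set (ZLat d)) : MeasurableSpace (DConf d) :=
  MeasurableSpace.comap (fun ω => fun x : Λ => ω x) inferInstance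

/-- `f` is a local function with support contained in the finite set `S`. -/
def LocalOn {d : ℕ} (f : DConf d → ℝ) (S : Finset (ZLat d)) : Prop :=
  ∀ σ τ : DConf d, (∀ x ∈ S, σ x = τ x) → f σ = f τ

/-- Sup norm of a real valued function. -/
def supNorm {α : Type*} (f : α → ℝ) : ℝ := ⨆ a, |f a|

/-- The `ℓ¹` distance between two finite subsets of the lattice. -/
def fDist1 {d : ℕ} (A B : Finset (ZLat d)) : ℝ :=
  sInf ((fun p : ZLat d × ZLat d => (D1 p.1 p.2 : ℝ)) '' {p | p.1 ∈ A ∧ p.2 ∈ B})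

/-- The decay condition (smin): exponential decay of correlations of `Q`. -/
def Smin {d : ℕ} (Q : Measure (DConf d)) (b'' B'' : ℝ) : Prop :=
  ∀ (f g : DConf d → ℝ) (Sf Sg : Finset (ZLat d)),
    LocalOn f Sf → LocalOn g Sg →
    (min Sf.card Sg.card : ℝ) * Real.exp (-b'' * fDist1 Sf Sg) ≤ 1 →
    |(∫ ω, f ω * g ω ∂Q) - (∫ ω, f ω ∂Q) * ∫ ω, g ω ∂Q| ≤
      B'' * supNorm f * supNorm g * (min Sf.card Sg.card : ℝ) *
        Real.exp (-b'' * fDist1 Sf Sg)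

/-- `θ_j = ∑_{i=0}^{j} (Γ_i + γ_i)`. -/
def theta (Γ γ : ℕ → ℝ) (j : ℕ) : ℝ := ∑ i ∈ Finset.range (j + 1), (Γ i + γ i)

/-- Moderately steep scales, with parameters `a > 0` and `ε ∈ (0,1)`
(items (1)–(5) of the definition). -/
structure ModSteep (d : ℕ) (Γ γ : ℕ → ℝ) (a ε : ℝ) : Prop where
  gammaBigMono : StrictMono Γ
  gammaSmallMono : StrictMono γ
  gammaBigZero : Γ 0 = 0
  gammaSmallZero : 0 ≤ γ 0
  gammaBigOne : 2 ≤ Γ 1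
  halfLt : ∀ j : ℕ, 1 ≤ j → Γ j < γ j / 2
  lam : ∀ j : ℕ, 10 * theta Γ γ j ≤ Γ (j + 1)
  covolSummable : Summable (fun j : ℕ => if j = 0 then (0 : ℝ) else Γ j / γ j)
  covol : (∑' j : ℕ, if j = 0 then (0 : ℝ) else Γ j / γ j) ≤ 1 / 2
  apos : 0 < a
  epsMem : ε ∈ Set.Ioo (0 : ℝ) 1
  growth : ∀ k : ℕ, 2 * 3 ^ d * theta Γ γ (k + 1) ^ d ≤ Real.exp (a * (1 + ε) ^ k)
  tail : ∀ s : ℝ, 0 ≤ s → ∀ q : ℝ, 1 < q →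
    Summable fun k : ℕ => theta Γ γ k ^ s * Real.exp (-a * (1 + ε) ^ k / q)

/-- `x` is a gentle point at level `k ≥ 1` with respect to the set `Bprev` of
`(k-1)`-bad points: `x ∈ Bprev`, the atom `A = O_{Γ_k}(x) ∩ Bprev` has `ℓ¹` diameter
at most `Γ_k`, and `D(A, Bprev ∖ A) > γ_k`. -/
def gentleOn {d : ℕ} (Γ γ : ℕ → ℝ) (Bprev : Set (ZLat d)) (k : ℕ) (x : ZLat d) : Prop :=
  x ∈ Bprev ∧
  (∀ u ∈ ball1 x (Γ k) ∩ Bprev, ∀ v ∈ ball1 x (Γ k) ∩ Bprev, (D1 u v : ℝ) ≤ Γ k) ∧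
  (∀ u ∈ ball1 x (Γ k) ∩ Bprev, ∀ v ∈ Bprev \ (ball1 x (Γ k) ∩ Bprev),
    γ k < (D1 u v : ℝ))

/-- The recursive classification of badness: `B_0(ω) = {x : ω_x = 1}` and
`B_k(ω) = B_{k-1}(ω)` minus the `k`-gentle points. -/
def badSet {d : ℕ} (Γ γ : ℕ → ℝ) (ω : DConf d) : ℕ → Set (ZLat d)
  | 0 => {x | ω x = true}
  | k + 1 => {x | x ∈ badSet Γ γ ω k ∧ ¬ gentleOn Γ γ (badSet Γ γ ω k) (k + 1) x}

/-- The `k`-gentle sites: `G_0(ω) = {x : ω_x = 0}`, `G_k(ω) = B_{k-1}(ω) ∖ B_k(ω)`. -/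
def gentleSet {d : ℕ} (Γ γ : ℕ → ℝ) (ω : DConf d) : ℕ → Set (ZLat d)
  | 0 => {x | ω x = false}
  | k + 1 => badSet Γ γ ω k \ badSet Γ γ ω (k + 1)

/-- The collection of `k`-gentle atoms `𝒢_k(ω)` (for `k ≥ 1`):
`A = O_{Γ_k}(x) ∩ B_{k-1}(ω)` for `x` a `k`-gentle point. -/
def atomsAt {d : ℕ} (Γ γ : ℕ → ℝ) (ω : DConf d) (k : ℕ) : Set (Set (ZLat d)) :=
  {A | ∃ x : ZLat d, gentleOn Γ γ (badSet Γ γ ω (k - 1)) k x ∧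
        A = ball1 x (Γ k) ∩ badSet Γ γ ω (k - 1)}

/-- The smallest coordinate parallelepiped `Env(g)` containing `g`. -/
def env {d : ℕ} (g : Set (ZLat d)) : Set (ZLat d) :=
  {x | ∀ i : Fin d, (∃ u ∈ g, u i ≤ x i) ∧ ∃ v ∈ g, x i ≤ v i}

/-- The residual bad sets of a graded family of atoms:
`B_0 = 𝕃 ∖ G_0`, `B_j = B_{j-1} ∖ ⋃(atoms of grade j)`. -/
def Bres {d : ℕ} (G0 : Set (ZLat d)) (atoms : ℕ → Set (Set (ZLat d))) : ℕ → Set (ZLat d)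
  | 0 => G0ᶜ
  | k + 1 => Bres G0 atoms k \ ⋃ g ∈ atoms (k + 1), g

/-- A gentle disintegration of `ℤ^d` with respect to `G0` and the scales `Γ, γ`. -/
structure GentleDisintegration (d : ℕ) (G0 : Set (ZLat d)) (Γ γ : ℕ → ℝ) where
  atoms : ℕ → Set (Set (ZLat d))
  atomFinite : ∀ j, ∀ g ∈ atoms j, g.Finite
  atomNonempty : ∀ j, ∀ g ∈ atoms j, g.Nonempty
  uniqueGrade : ∀ j j' g, g ∈ atoms j → g ∈ atoms j' → j = j'
  pairwiseDisjoint : ∀ j j' g g', g ∈ atoms j → g' ∈ atoms j' → g ≠ g' → Disjoint g g'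
  cover : ∀ x : ZLat d, ∃ j, ∃ g ∈ atoms j, x ∈ g
  grade0 : atoms 0 = {s | ∃ x ∈ G0, s = {x}}
  subsBad : ∀ j, ∀ g ∈ atoms (j + 1), g ⊆ Bres G0 atoms j
  diamBound : ∀ j, 1 ≤ j → ∀ g ∈ atoms j, ∀ u ∈ g, ∀ v ∈ g, (D1 u v : ℝ) ≤ Γ j
  separation : ∀ j, ∀ g ∈ atoms (j + 1), ∀ u ∈ g, ∀ v ∈ Bres G0 atoms j \ g,
    γ (j + 1) < (D1 u v : ℝ)
  horizon : ∀ x : ZLat d,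
    {j : ℕ | 1 ≤ j ∧ ∃ g ∈ atoms j, ∃ y ∈ env g, (supD x y : ℝ) ≤ theta Γ γ j}.Finite


section Distances

variable {d : ℕ}

lemma D1_self (x : ZLat d) : D1 x x = 0 := by simp [D1]

lemma D1_comm (x y : ZLat d) : D1 x y = D1 y x := by
  unfold D1
  exact Finset.sum_congr rfl fun i _ => by omega

lemma D1_triangle (x y z : ZLat d) : (D1 x z : ℝ) ≤ D1 x y + D1 y z := by
  have h : D1 x z ≤ D1 x y + D1 y z := by
    unfold D1
    rw [← Finset.sum_add_distrib]
    exact Finset.sum_le_sum fun i _ => by omega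
  exact_mod_cast h

lemma natAbs_le_D1 (x y : ZLat d) (i : Fin d) : (x i - y i).natAbs ≤ D1 x y :=
  Finset.single_le_sum (f := fun i => (x i - y i).natAbs) (fun _ _ => Nat.zero_le _)
    (Finset.mem_univ i)

/-- The sup-distance ball of radius `n` around `x`, as a finite set. -/
def supBox (x : ZLat d) (n : ℕ) : Finset (ZLat d) :=
  Finset.Icc (fun i => x i - n) (fun i => x i + n)

lemma mem_supBox {x y : ZLat d} {n : ℕ} : y ∈ supBox x n ↔ ∀ i, (x i - y i).natAbs ≤ n := by
  simp only [supBox, Finset.mem_Icc, Pi.le_def]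
  constructor
  · rintro ⟨h1, h2⟩ i
    have := h1 i
    have := h2 i
    omega
  · intro h
    constructor <;> intro i <;> have := h i <;> omega

lemma card_supBox (x : ZLat d) (n : ℕ) : (supBox x n).card = (2 * n + 1) ^ d := by
  rw [supBox, Pi.card_Icc]
  have h : ∀ i : Fin d, (Finset.Icc (x i - n) (x i + n : ℤ)).card = 2 * n + 1 := fun i => by
    rw [Int.card_Icc]
    omega
  simp [h]

open Classical in
/-- The `ℓ¹` ball as a finite set. -/
def ballFin (x : ZLat d) (r : ℝ) : Finset (ZLat d) :=
  (supBox x ⌊r⌋₊).filter fun y => (D1 x y : ℝ) ≤ r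

lemma mem_ballFin {x y : ZLat d} {r : ℝ} : y ∈ ballFin x r ↔ (D1 x y : ℝ) ≤ r := by
  simp only [ballFin, Finset.mem_filter, and_iff_right_iff_imp]
  intro h
  exact mem_supBox.2 fun i => (natAbs_le_D1 x y i).trans (Nat.le_floor h)

lemma card_supBox_le (x : ZLat d) {r t c : ℝ} (hr : 0 ≤ r) (h : 2 * r + 1 ≤ c * t) :
    ((supBox x ⌊r⌋₊).card : ℝ) ≤ c ^ d * t ^ d := by
  rw [card_supBox, ← mul_pow]
  push_cast
  have := Nat.floor_le hr
  gcongr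
  linarith

lemma card_ballFin_le (x : ZLat d) {r t : ℝ} (hr : 0 ≤ r) (hrt : r ≤ t) (ht : 1 ≤ t) :
    ((ballFin x r).card : ℝ) ≤ 3 ^ d * t ^ d := by
  refine le_trans ?_ (card_supBox_le x hr (by linarith))
  exact_mod_cast Finset.card_filter_le _ _

lemma le_fDist1 {A B : Finset (ZLat d)} {r : ℝ} (hA : A.Nonempty) (hB : B.Nonempty)
    (h : ∀ u ∈ A, ∀ v ∈ B, r ≤ (D1 u v : ℝ)) : r ≤ fDist1 A B := by
  obtain ⟨u, hu⟩ := hA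
  obtain ⟨v, hv⟩ := hB
  refine le_csInf ⟨_, ⟨(u, v), ⟨hu, hv⟩, rfl⟩⟩ ?_
  rintro _ ⟨⟨u', v'⟩, ⟨hu', hv'⟩, rfl⟩
  exact h u' hu' v' hv'

end Distances

section BadSets

variable {d : ℕ} {Γ γ : ℕ → ℝ}

lemma badSet_subset_zero (ω : DConf d) (k : ℕ) : badSet Γ γ ω k ⊆ badSet Γ γ ω 0 := by
  induction k with
  | zero => exact subset_rfl
  | succ k ih => exact fun x hx => ih hx.1

lemma gentleOn_of_agree {B B' : Set (ZLat d)} {k : ℕ} {x : ZLat d}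
    (hΓ : 0 ≤ Γ k) (hγ : 0 ≤ γ k)
    (h : ∀ y, (D1 x y : ℝ) ≤ Γ k + γ k → (y ∈ B ↔ y ∈ B')) (hg : gentleOn Γ γ B k x) :
    gentleOn Γ γ B' k x := by
  obtain ⟨h1, h2, h3⟩ := hg
  have hx : (D1 x x : ℝ) ≤ Γ k + γ k := by
    rw [D1_self]
    push_cast
    linarith
  have hball : ∀ u ∈ ball1 x (Γ k) ∩ B', u ∈ ball1 x (Γ k) ∩ B := by
    rintro u ⟨hu, hu'⟩
    have hu2 : (D1 x u : ℝ) ≤ Γ k := hu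
    exact ⟨hu, (h u (by linarith)).2 hu'⟩
  refine ⟨(h x hx).1 h1, fun u hu v hv => h2 u (hball u hu) v (hball v hv), ?_⟩
  rintro u hu v ⟨hv, hv'⟩
  by_contra hc
  have hu2 : (D1 x u : ℝ) ≤ Γ k := hu.1
  have := D1_triangle x u v
  have hvB : v ∈ B := (h v (by linarith [not_lt.1 hc])).2 hv
  exact hc (h3 u (hball u hu) v ⟨hvB, fun hv2 => hv' ⟨hv2.1, hv⟩⟩)

lemma theta_succ (Γ γ : ℕ → ℝ) (k : ℕ) :
    theta Γ γ (k + 1) = theta Γ γ k + (Γ (k + 1) + γ (k + 1)) := by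
  simp [theta, Finset.sum_range_succ _ (k + 1)]

/-- Whether `x` is `k`-bad only depends on the disorder at `ℓ¹` distance `θ_k - θ_0` of `x`. -/
lemma mem_badSet_congr (hΓ : ∀ j, 0 ≤ Γ j) (hγ : ∀ j, 0 ≤ γ j) (k : ℕ) :
    ∀ (x : ZLat d) (ω ω' : DConf d),
      (∀ y, (D1 x y : ℝ) ≤ theta Γ γ k - theta Γ γ 0 → ω y = ω' y) →
      (x ∈ badSet Γ γ ω k ↔ x ∈ badSet Γ γ ω' k) := by
  induction k with
  | zero =>
    intro x ω ω' h
    have := h x (by simp [D1_self])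
    simp [badSet, this]
  | succ k ih =>
    intro x ω ω' h
    have hθ := theta_succ Γ γ k
    have key : ∀ y, (D1 x y : ℝ) ≤ Γ (k + 1) + γ (k + 1) →
        (y ∈ badSet Γ γ ω k ↔ y ∈ badSet Γ γ ω' k) := by
      intro y hy
      refine ih y ω ω' fun z hz => h z ?_
      have := D1_triangle x y z
      linarith
    have hx : (D1 x x : ℝ) ≤ Γ (k + 1) + γ (k + 1) := by
      rw [D1_self]
      have := hΓ (k + 1)
      have := hγ (k + 1)
      push_cast
      linarith
    have hgentle : gentleOn Γ γ (badSet Γ γ ω k) (k + 1) x ↔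
        gentleOn Γ γ (badSet Γ γ ω' k) (k + 1) x :=
      ⟨gentleOn_of_agree (hΓ _) (hγ _) key,
        gentleOn_of_agree (hΓ _) (hγ _) fun y hy => (key y hy).symm⟩
    simp only [badSet, Set.mem_ofPred_eq, key x hx, hgentle]

/-- A bad point which is not gentle has another bad point at intermediate distance. -/
lemma exists_bad_of_not_gentle {B : Set (ZLat d)} {k : ℕ} {x : ZLat d}
    (hΓ : 0 ≤ Γ k) (hγ : 0 ≤ γ k) (hx : x ∈ B) (hg : ¬ gentleOn Γ γ B k x) :
    ∃ y ∈ B, Γ k / 2 < (D1 x y : ℝ) ∧ (D1 x y : ℝ) ≤ Γ k + γ k := by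
  by_contra hc
  push Not at hc
  refine hg ⟨hx, ?_, ?_⟩
  · rintro u ⟨hu, huB⟩ v ⟨hv, hvB⟩
    have hu' : (D1 x u : ℝ) ≤ Γ k := hu
    have hv' : (D1 x v : ℝ) ≤ Γ k := hv
    have h1 : (D1 x u : ℝ) ≤ Γ k / 2 := by
      by_contra h
      have := hc u huB (not_le.1 h)
      linarith
    have h2 : (D1 x v : ℝ) ≤ Γ k / 2 := by
      by_contra h
      have := hc v hvB (not_le.1 h)
      linarith
    have := D1_triangle u x v
    rw [D1_comm u x] at this
    linarith
  · rintro u ⟨hu, huB⟩ v ⟨hvB, hv⟩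
    have hu' : (D1 x u : ℝ) ≤ Γ k := hu
    have hv' : Γ k < (D1 x v : ℝ) := by
      by_contra h
      exact hv ⟨not_lt.1 h, hvB⟩
    have := hc v hvB (by linarith)
    have := D1_triangle x u v
    linarith

lemma measurableSet_mem_badSet (k : ℕ) :
    ∀ x : ZLat d, MeasurableSet {ω : DConf d | x ∈ badSet Γ γ ω k} := by
  induction k with
  | zero =>
    intro x
    exact measurableSet_eq_fun (measurable_pi_apply x) measurable_const
  | succ k ih =>
    intro x
    have hball : ∀ u, MeasurableSet
        {ω : DConf d | u ∈ ball1 x (Γ (k + 1)) ∩ badSet Γ γ ω k} := fun u =>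
      (MeasurableSet.const _).inter (ih u)
    refine (ih x).inter (MeasurableSet.compl ?_)
    refine (ih x).inter (MeasurableSet.inter ?_ ?_)
    · refine measurableSet_setOfPred.2 (.forall fun u => .imp (measurableSet_setOfPred.1 (hball u)) ?_)
      exact .forall fun v => .imp (measurableSet_setOfPred.1 (hball v)) measurable_const
    · refine measurableSet_setOfPred.2 (.forall fun u => .imp (measurableSet_setOfPred.1 (hball u)) ?_)
      refine .forall fun v => .imp (measurableSet_setOfPred.1 ?_) measurable_const
      exact (ih v).diff (hball v)

/-- If the envelope of a `k`-gentle atom is within sup-distance `t` of `x`, then there is a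
`(k-1)`-bad point within sup-distance `t + Γ_k` of `x`. -/
lemma exists_bad_of_atom {ω : DConf d} {k : ℕ} {x y : ZLat d} {t : ℝ} (hΓ : 0 ≤ Γ k)
    {g : Set (ZLat d)} (hg : g ∈ atomsAt Γ γ ω k) (hy : y ∈ env g) (hxy : (supD x y : ℝ) ≤ t) :
    ∃ z ∈ supBox x ⌊t + Γ k⌋₊, z ∈ badSet Γ γ ω (k - 1) := by
  obtain ⟨z, hz, rfl⟩ := hg
  refine ⟨z, mem_supBox.2 fun i => Nat.le_floor ?_, hz.1⟩
  obtain ⟨⟨u, hu, huy⟩, v, hv, hvy⟩ := hy i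
  have hu' : ((z i - u i).natAbs : ℝ) ≤ Γ k :=
    le_trans (by exact_mod_cast natAbs_le_D1 z u i) (show (D1 z u : ℝ) ≤ Γ k from hu.1)
  have hv' : ((z i - v i).natAbs : ℝ) ≤ Γ k :=
    le_trans (by exact_mod_cast natAbs_le_D1 z v i) (show (D1 z v : ℝ) ≤ Γ k from hv.1)
  have hxy' : ((x i - y i).natAbs : ℝ) ≤ t := by
    refine le_trans ?_ hxy
    exact_mod_cast Finset.le_sup (f := fun i => (x i - y i).natAbs) (Finset.mem_univ i)
  have hzy : ((z i - y i).natAbs : ℝ) ≤ Γ k := by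
    rw [← Nat.le_floor_iff hΓ] at hu' hv' ⊢
    omega
  have hsum : (x i - z i).natAbs ≤ (x i - y i).natAbs + (z i - y i).natAbs := by omega
  have : ((x i - z i).natAbs : ℝ) ≤ (x i - y i).natAbs + (z i - y i).natAbs := by
    exact_mod_cast hsum
  linarith

end BadSets

section Decay

variable {d : ℕ} {Q : Measure (DConf d)} {b'' B'' : ℝ}

/-- The decay condition for events depending on finitely many sites. -/
lemma Smin.measureReal_inter_le (hQ : Smin Q b'' B'') (hb : 0 < b'') (hB : 0 < B'')
    {A A' : Set (DConf d)} (hA : MeasurableSet A) (hA' : MeasurableSet A')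
    {S S' : Finset (ZLat d)}
    (hS : ∀ σ τ : DConf d, (∀ x ∈ S, σ x = τ x) → (σ ∈ A ↔ τ ∈ A))
    (hS' : ∀ σ τ : DConf d, (∀ x ∈ S', σ x = τ x) → (σ ∈ A' ↔ τ ∈ A'))
    {N r : ℝ} (hN : (S.card : ℝ) ≤ N) (hr : r ≤ fDist1 S S')
    (h1 : N * Real.exp (-b'' * r) ≤ 1) :
    Q.real (A ∩ A') ≤ Q.real A * Q.real A' + B'' * (N * Real.exp (-b'' * r)) := by
  classical
  have hloc : ∀ {A : Set (DConf d)} {S : Finset (ZLat d)},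
      (∀ σ τ : DConf d, (∀ x ∈ S, σ x = τ x) → (σ ∈ A ↔ τ ∈ A)) →
      LocalOn (A.indicator (1 : DConf d → ℝ)) S := by
    intro A S hS σ τ h
    simp [Set.indicator_apply, hS σ τ h]
  have hnorm : ∀ A : Set (DConf d), supNorm (A.indicator (1 : DConf d → ℝ)) ≤ 1 := by
    intro A
    refine ciSup_le fun σ => ?_
    by_cases h : σ ∈ A <;> simp [h]
  have hnorm0 : ∀ A : Set (DConf d), 0 ≤ supNorm (A.indicator (1 : DConf d → ℝ)) :=
    fun A => Real.iSup_nonneg fun σ => abs_nonneg _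
  have hmin : (min S.card S'.card : ℝ) * Real.exp (-b'' * fDist1 S S') ≤
      N * Real.exp (-b'' * r) := by
    have hN0 : 0 ≤ N := le_trans (Nat.cast_nonneg _) hN
    refine mul_le_mul ((min_le_left _ _).trans hN) (Real.exp_le_exp.2 ?_) (Real.exp_pos _).le hN0
    nlinarith
  have hmin0 : 0 ≤ (min S.card S'.card : ℝ) * Real.exp (-b'' * fDist1 S S') := by positivity
  have hcov := hQ _ _ S S' (hloc hS) (hloc hS') (hmin.trans h1)
  have hmul : ∀ ω, A.indicator (1 : DConf d → ℝ) ω * A'.indicator (1 : DConf d → ℝ) ω =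
      (A ∩ A').indicator (1 : DConf d → ℝ) ω := by
    intro ω
    rw [Set.inter_indicator_one, Pi.mul_apply]
  simp only [hmul] at hcov
  rw [integral_indicator_one (hA.inter hA'), integral_indicator_one hA,
    integral_indicator_one hA'] at hcov
  have hbound : B'' * supNorm (A.indicator (1 : DConf d → ℝ)) *
      supNorm (A'.indicator (1 : DConf d → ℝ)) * (min S.card S'.card : ℝ) *
        Real.exp (-b'' * fDist1 S S') ≤ B'' * (N * Real.exp (-b'' * r)) := by
    rw [mul_assoc, mul_assoc B'', mul_assoc B'']
    refine mul_le_mul_of_nonneg_left ?_ hB.le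
    have := mul_le_one₀ (hnorm A) (hnorm0 A') (hnorm A')
    exact (mul_le_of_le_one_left hmin0 this).trans hmin
  have := (abs_le.1 (hcov.trans hbound)).2
  linarith

/-- The decay condition at distance zero bounds the variance of a single site. -/
lemma Smin.measureReal_site_le (hQ : Smin Q b'' B'') (hb : 0 < b'') (hB : 0 < B'') (x : ZLat d)
    (hx : Q.real {ω | ω x = true} ≤ 1 / 2) : Q.real {ω | ω x = true} ≤ 2 * B'' := by
  have hm : MeasurableSet {ω : DConf d | ω x = true} :=
    measurableSet_eq_fun (measurable_pi_apply x) measurable_const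
  have hl : ∀ σ τ : DConf d, (∀ y ∈ ({x} : Finset (ZLat d)), σ y = τ y) →
      (σ ∈ {ω : DConf d | ω x = true} ↔ τ ∈ {ω : DConf d | ω x = true}) := by
    intro σ τ h
    simp [h x (Finset.mem_singleton_self x)]
  have h := hQ.measureReal_inter_le hb hB hm hm hl hl (N := 1) (r := 0) (by simp)
    (le_fDist1 (by simp) (by simp) fun _ _ _ _ => Nat.cast_nonneg _) (by simp)
  rw [Set.inter_self] at h
  simp only [mul_zero, Real.exp_zero, mul_one] at h
  nlinarith [measureReal_nonneg (μ := Q) (s := {ω : DConf d | ω x = true})]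

end Decay

section Scales

variable {d : ℕ} {Γ γ : ℕ → ℝ} {a ε : ℝ}

lemma ModSteep.gammaBig_nonneg (hs : ModSteep d Γ γ a ε) (j : ℕ) : 0 ≤ Γ j :=
  hs.gammaBigZero ▸ hs.gammaBigMono.monotone (Nat.zero_le j)

lemma ModSteep.gammaSmall_nonneg (hs : ModSteep d Γ γ a ε) (j : ℕ) : 0 ≤ γ j :=
  hs.gammaSmallZero.trans (hs.gammaSmallMono.monotone (Nat.zero_le j))

lemma ModSteep.theta_nonneg (hs : ModSteep d Γ γ a ε) (k : ℕ) : 0 ≤ theta Γ γ k :=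
  Finset.sum_nonneg fun i _ => add_nonneg (hs.gammaBig_nonneg i) (hs.gammaSmall_nonneg i)

lemma ModSteep.two_le_theta_succ (hs : ModSteep d Γ γ a ε) (k : ℕ) : 2 ≤ theta Γ γ (k + 1) := by
  have h1 := hs.gammaBigMono.monotone (Nat.le_add_left 1 k)
  have := hs.gammaBigOne
  have := hs.theta_nonneg k
  have := hs.gammaSmall_nonneg (k + 1)
  rw [theta_succ]
  linarith

variable {Q : Measure (DConf d)} [IsProbabilityMeasure Q] {b'' B'' : ℝ}

/-- The probability of being `k`-bad is superexponentially small in `k`. -/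
lemma ModSteep.measureReal_badSet_le (hs : ModSteep d Γ γ a ε)
    (hb : 0 < b'') (hB : 0 < B'') (hQ : Smin Q b'' B'')
    (hp : ∀ x : ZLat d, Q {ω | ω x = true} ≤ ENNReal.ofReal (Real.exp (-a / (1 - ε))))
    (hgag : ∀ k : ℕ,
      2 * 9 ^ d * B'' * theta Γ γ (k + 1) ^ (2 * d) * Real.exp (-b'' * Γ (k + 1) / 20) ≤
        Real.exp (-(a / (1 - ε)) * (1 + ε) ^ (k + 1))) (k : ℕ) :
    ∀ x : ZLat d, Q.real {ω | x ∈ badSet Γ γ ω k} ≤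
      Real.exp (-(a / (1 - ε)) * (1 + ε) ^ k) := by
  classical
  have ha := hs.apos
  obtain ⟨hε0, hε1⟩ := hs.epsMem
  have hsite : ∀ x : ZLat d, Q.real {ω | ω x = true} ≤ Real.exp (-a / (1 - ε)) := fun x =>
    ENNReal.toReal_le_of_le_ofReal (Real.exp_pos _).le (hp x)
  have hN1 : ∀ k, 1 ≤ (3 : ℝ) ^ d * theta Γ γ (k + 1) ^ d := by
    intro k
    have := hs.two_le_theta_succ k
    exact one_le_mul_of_one_le_of_one_le (one_le_pow₀ (by norm_num)) (one_le_pow₀ (by linarith))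
  have hhalf : Real.exp (-a / (1 - ε)) ≤ 1 / 2 := by
    have h1 : 2 ≤ Real.exp a := by
      have h2 := hs.growth 0
      have h3 := hN1 0
      simp only [pow_zero, mul_one] at h2
      linarith
    have h4 : Real.exp (-a / (1 - ε)) ≤ Real.exp (-a) := by
      refine Real.exp_le_exp.2 ?_
      rw [div_le_iff₀ (by linarith)]
      nlinarith
    rw [Real.exp_neg] at h4
    refine h4.trans ?_
    rw [one_div]
    exact inv_anti₀ (by norm_num) h1
  induction k with
  | zero =>
    intro x
    refine (hsite x).trans (le_of_eq ?_)
    congr 1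
    ring
  | succ k ih =>
    intro x
    set N : ℝ := 3 ^ d * theta Γ γ (k + 1) ^ d with hN
    set E : ℝ := Real.exp (-b'' * Γ (k + 1) / 20) with hE
    have hE0 : 0 < E := Real.exp_pos _
    have hΓ := hs.gammaBig_nonneg (k + 1)
    have hγ := hs.gammaSmall_nonneg (k + 1)
    have hθk := hs.theta_nonneg k
    have hθ0 := hs.theta_nonneg 0
    have hlam := hs.lam k
    have hθ2 := hs.two_le_theta_succ k
    have hθs := theta_succ Γ γ k
    have hNk : 1 ≤ N := hN1 k
    have hE1 : E ≤ 1 := Real.exp_le_one_iff.2 (by nlinarith [mul_nonneg hb.le hΓ])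
    have hE6 : Real.exp (-b'' * (3 / 10 * Γ (k + 1))) = E ^ 6 := by
      rw [hE, ← Real.exp_nat_mul]
      congr 1
      push_cast
      ring
    have hE6E : E ^ 6 ≤ E := pow_le_of_le_one hE0.le hE1 (by norm_num)
    have hgagN : 2 * B'' * N ^ 2 * E ≤ Real.exp (-(a / (1 - ε)) * (1 + ε) ^ (k + 1)) := by
      refine le_trans (le_of_eq ?_) (hgag k)
      have h9 : (9 : ℝ) ^ d = (3 ^ d) ^ 2 := by
        rw [← pow_mul, mul_comm, pow_mul]
        norm_num
      rw [hN, h9, mul_comm 2 d, pow_mul]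
      ring
    by_cases hcase : N * E ^ 6 ≤ 1
    · set T : Finset (ZLat d) := (ballFin x (Γ (k + 1) + γ (k + 1))).filter
        fun y => Γ (k + 1) / 2 < (D1 x y : ℝ)
      have hTcard : (T.card : ℝ) ≤ N := by
        refine le_trans ?_ (card_ballFin_le x (add_nonneg hΓ hγ) (t := theta Γ γ (k + 1))
          (by linarith) (by linarith))
        exact_mod_cast Finset.card_filter_le _ _
      have hcover : {ω | x ∈ badSet Γ γ ω (k + 1)} ⊆
          ⋃ y ∈ T, ({ω | x ∈ badSet Γ γ ω k} ∩ {ω | y ∈ badSet Γ γ ω k}) := by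
        rintro ω ⟨hx, hg⟩
        obtain ⟨y, hy, h1, h2⟩ := exists_bad_of_not_gentle hΓ hγ hx hg
        simp only [Set.mem_iUnion]
        exact ⟨y, Finset.mem_filter.2 ⟨mem_ballFin.2 h2, h1⟩, hx, hy⟩
      have hlocal : ∀ z : ZLat d, ∀ σ τ : DConf d,
          (∀ y ∈ ballFin z (theta Γ γ k - theta Γ γ 0), σ y = τ y) →
          (σ ∈ {ω | z ∈ badSet Γ γ ω k} ↔ τ ∈ {ω | z ∈ badSet Γ γ ω k}) :=
        fun z σ τ h => mem_badSet_congr hs.gammaBig_nonneg hs.gammaSmall_nonneg k z σ τ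
          fun y hy => h y (mem_ballFin.2 hy)
      have hθ0k : theta Γ γ 0 ≤ theta Γ γ k :=
        Finset.sum_le_sum_of_subset_of_nonneg (Finset.range_mono (by omega)) fun i _ _ =>
          add_nonneg (hs.gammaBig_nonneg i) (hs.gammaSmall_nonneg i)
      have hself : ∀ z : ZLat d, (ballFin z (theta Γ γ k - theta Γ γ 0)).Nonempty :=
        fun z => ⟨z, mem_ballFin.2 (by rw [D1_self]; push_cast; linarith)⟩
      have hpair : ∀ y ∈ T,
          Q.real ({ω | x ∈ badSet Γ γ ω k} ∩ {ω | y ∈ badSet Γ γ ω k}) ≤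
            Real.exp (-(a / (1 - ε)) * (1 + ε) ^ k) ^ 2 + B'' * (N * E) := by
        intro y hy
        have hxy : Γ (k + 1) / 2 < (D1 x y : ℝ) := (Finset.mem_filter.1 hy).2
        have h := hQ.measureReal_inter_le hb hB (measurableSet_mem_badSet (Γ := Γ) (γ := γ) k x)
          (measurableSet_mem_badSet k y) (hlocal x) (hlocal y) (N := N)
          (r := 3 / 10 * Γ (k + 1))
          (card_ballFin_le x (by linarith) (by linarith) (by linarith))
          (le_fDist1 (hself x) (hself y) ?_) (by rwa [hE6])
        · refine h.trans (add_le_add ?_ ?_)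
          · rw [sq]
            exact mul_le_mul (ih x) (ih y) measureReal_nonneg (Real.exp_pos _).le
          · rw [hE6]
            gcongr
        · intro u hu v hv
          have hu' := mem_ballFin.1 hu
          have hv' := mem_ballFin.1 hv
          have h1 := D1_triangle x u y
          have h2 := D1_triangle u v y
          rw [D1_comm v y] at h2
          linarith
      have hsq : N * Real.exp (-(a / (1 - ε)) * (1 + ε) ^ k) ^ 2 ≤
          Real.exp (-(a / (1 - ε)) * (1 + ε) ^ (k + 1)) / 2 := by
        have hgr : 2 * N ≤ Real.exp (a * (1 + ε) ^ k) := by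
          have := hs.growth k
          rw [hN]
          linarith
        have hexp : Real.exp (a * (1 + ε) ^ k) * Real.exp (-(a / (1 - ε)) * (1 + ε) ^ k) ^ 2 =
            Real.exp (-(a / (1 - ε)) * (1 + ε) ^ (k + 1)) := by
          rw [← Real.exp_nat_mul, ← Real.exp_add]
          congr 1
          have : 1 - ε ≠ 0 := by linarith
          field_simp
          push_cast
          ring
        rw [← hexp]
        nlinarith [mul_le_mul_of_nonneg_right hgr
          (sq_nonneg (Real.exp (-(a / (1 - ε)) * (1 + ε) ^ k)))]
      calc Q.real {ω | x ∈ badSet Γ γ ω (k + 1)}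
          ≤ Q.real (⋃ y ∈ T, ({ω | x ∈ badSet Γ γ ω k} ∩ {ω | y ∈ badSet Γ γ ω k})) :=
            measureReal_mono hcover (measure_ne_top _ _)
        _ ≤ ∑ y ∈ T, Q.real ({ω | x ∈ badSet Γ γ ω k} ∩ {ω | y ∈ badSet Γ γ ω k}) :=
            measureReal_biUnion_finset_le _ _
        _ ≤ T.card * (Real.exp (-(a / (1 - ε)) * (1 + ε) ^ k) ^ 2 + B'' * (N * E)) := by
            rw [← nsmul_eq_mul]
            exact Finset.sum_le_card_nsmul _ _ _ hpair
        _ ≤ N * (Real.exp (-(a / (1 - ε)) * (1 + ε) ^ k) ^ 2 + B'' * (N * E)) := by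
            gcongr
        _ ≤ Real.exp (-(a / (1 - ε)) * (1 + ε) ^ (k + 1)) := by
            linarith
    · -- The decay condition is void at this scale, but then `B''`, hence `p`, is tiny.
      have hNE : 1 ≤ N * E :=
        (not_le.1 hcase).le.trans (mul_le_mul_of_nonneg_left hE6E (by linarith))
      have hmono : Q.real {ω | x ∈ badSet Γ γ ω (k + 1)} ≤ Q.real {ω | ω x = true} :=
        measureReal_mono fun ω hω => badSet_subset_zero ω (k + 1) hω
      have hsm := hQ.measureReal_site_le hb hB x ((hsite x).trans hhalf)
      have h2B : 2 * B'' * 1 ≤ 2 * B'' * (N * (N * E)) :=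
        mul_le_mul_of_nonneg_left (one_le_mul_of_one_le_of_one_le hNk hNE) (by linarith)
      calc _ ≤ 2 * B'' * 1 := by linarith
        _ ≤ 2 * B'' * (N * (N * E)) := h2B
        _ = 2 * B'' * N ^ 2 * E := by ring
        _ ≤ _ := hgagN

/-- The bad points of level `k` are summably rare in boxes of size `θ_{k+1} + Γ_{k+1}`. -/
lemma ModSteep.ae_finite_bad_box (hs : ModSteep d Γ γ a ε)
    (hbad : ∀ (k : ℕ) (x : ZLat d), Q.real {ω | x ∈ badSet Γ γ ω k} ≤
      Real.exp (-(a / (1 - ε)) * (1 + ε) ^ k)) (x : ZLat d) :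
    ∀ᵐ ω ∂Q, {k : ℕ | ∃ z ∈ supBox x ⌊theta Γ γ (k + 1) + Γ (k + 1)⌋₊,
      z ∈ badSet Γ γ ω k}.Finite := by
  have ha := hs.apos
  obtain ⟨hε0, hε1⟩ := hs.epsMem
  set F : ℕ → Set (DConf d) := fun k =>
    {ω | ∃ z ∈ supBox x ⌊theta Γ γ (k + 1) + Γ (k + 1)⌋₊, z ∈ badSet Γ γ ω k}
  have hFle : ∀ k, Q.real (F k) ≤ 5 ^ d *
      (theta Γ γ (k + 1) ^ (d : ℝ) * Real.exp (-a * (1 + ε) ^ (k + 1) / 2)) := by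
    intro k
    have hΓ := hs.gammaBig_nonneg (k + 1)
    have hγ := hs.gammaSmall_nonneg (k + 1)
    have hθk := hs.theta_nonneg k
    have hθs := theta_succ Γ γ k
    have hθ2 := hs.two_le_theta_succ k
    have hcover : F k ⊆ ⋃ z ∈ supBox x ⌊theta Γ γ (k + 1) + Γ (k + 1)⌋₊,
        {ω | z ∈ badSet Γ γ ω k} := by
      rintro ω ⟨z, hz, hzb⟩
      simp only [Set.mem_iUnion]
      exact ⟨z, hz, hzb⟩
    have hexp : Real.exp (-(a / (1 - ε)) * (1 + ε) ^ k) ≤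
        Real.exp (-a * (1 + ε) ^ (k + 1) / 2) := by
      refine Real.exp_le_exp.2 ?_
      have h1 : a ≤ a / (1 - ε) := by
        rw [le_div_iff₀ (by linarith)]
        nlinarith
      have hpow : 0 < (1 + ε) ^ k := by positivity
      rw [pow_succ]
      nlinarith [mul_le_mul_of_nonneg_right h1 hpow.le, mul_pos ha hpow,
        mul_lt_mul_of_pos_left hε1 (mul_pos ha hpow)]
    calc Q.real (F k)
        ≤ Q.real (⋃ z ∈ supBox x ⌊theta Γ γ (k + 1) + Γ (k + 1)⌋₊,
            {ω | z ∈ badSet Γ γ ω k}) := measureReal_mono hcover (measure_ne_top _ _)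
      _ ≤ ∑ z ∈ supBox x ⌊theta Γ γ (k + 1) + Γ (k + 1)⌋₊,
            Q.real {ω | z ∈ badSet Γ γ ω k} := measureReal_biUnion_finset_le _ _
      _ ≤ (supBox x ⌊theta Γ γ (k + 1) + Γ (k + 1)⌋₊).card *
            Real.exp (-(a / (1 - ε)) * (1 + ε) ^ k) := by
          rw [← nsmul_eq_mul]
          exact Finset.sum_le_card_nsmul _ _ _ fun z _ => hbad k z
      _ ≤ (5 ^ d * theta Γ γ (k + 1) ^ d) * Real.exp (-a * (1 + ε) ^ (k + 1) / 2) :=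
          mul_le_mul (card_supBox_le x (by linarith) (by linarith)) hexp (Real.exp_pos _).le
            (by positivity)
      _ = _ := by rw [Real.rpow_natCast, mul_assoc]
  have hsum : Summable fun k => Q.real (F k) := by
    refine Summable.of_nonneg_of_le (fun _ => measureReal_nonneg) hFle (Summable.mul_left _ ?_)
    exact (summable_nat_add_iff 1).2 (hs.tail d (Nat.cast_nonneg d) 2 one_lt_two)
  have htsum : ∑' k, Q (F k) ≠ ⊤ := by
    have : ∀ k, Q (F k) = ENNReal.ofReal (Q.real (F k)) := fun k =>
      (ofReal_measureReal (measure_ne_top _ _)).symm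
    simp only [this]
    exact hsum.tsum_ofReal_ne_top
  exact ae_finite_setOfPred_mem htsum

end Scales

/-- Almost-sure finiteness of the gentleness horizon. Under the
hypotheses of the gentle-disintegration theorem, for `Q`-almost every `ω`, for every
`x ∈ ℤ^d` the set of levels `j ≥ 1` admitting a `j`-gentle atom `g ∈ 𝒢_j(ω)` with
`sup`-distance from `x` to `Env(g)` at most `θ_j` is finite. -/
theorem stmt11 {d : ℕ} (Γ γ : ℕ → ℝ) (a ε : ℝ) (hs : ModSteep d Γ γ a ε)
    (Q : Measure (DConf d)) [IsProbabilityMeasure Q]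
    (b'' B'' : ℝ) (hb : 0 < b'') (hB : 0 < B'') (hQ : Smin Q b'' B'')
    (hp : ∀ x : ZLat d,
      Q {ω | ω x = true} ≤ ENNReal.ofReal (Real.exp (-a / (1 - ε))))
    (hgag : ∀ k : ℕ,
      2 * 9 ^ d * B'' * theta Γ γ (k + 1) ^ (2 * d) *
          Real.exp (-b'' * Γ (k + 1) / 20) ≤
        Real.exp (-(a / (1 - ε)) * (1 + ε) ^ (k + 1))) :
    ∃ Ωbar : Set (DConf d), MeasurableSet Ωbar ∧ Q Ωbar = 1 ∧
      ∀ ω ∈ Ωbar, ∀ x : ZLat d,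
        {j : ℕ | 1 ≤ j ∧ ∃ g ∈ atomsAt Γ γ ω j, ∃ y ∈ env g,
          (supD x y : ℝ) ≤ theta Γ γ j}.Finite := by
  have hbad := hs.measureReal_badSet_le hb hB hQ hp hgag
  have hae : ∀ᵐ ω ∂Q, ∀ x : ZLat d,
      {j : ℕ | 1 ≤ j ∧ ∃ g ∈ atomsAt Γ γ ω j, ∃ y ∈ env g,
        (supD x y : ℝ) ≤ theta Γ γ j}.Finite := by
    refine ae_all_iff.2 fun x => ?_
    filter_upwards [hs.ae_finite_bad_box hbad x] with ω hω
    refine (hω.image (· + 1)).subset ?_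
    rintro j ⟨hj, g, hg, y, hy, hxy⟩
    obtain ⟨k, rfl⟩ : ∃ k, j = k + 1 := ⟨j - 1, by omega⟩
    exact ⟨k, exists_bad_of_atom (hs.gammaBig_nonneg _) hg hy hxy, rfl⟩
  obtain ⟨s, hs_sub, hs_meas, hs_zero⟩ :=
    exists_measurable_superset_of_null (ae_iff.1 hae)
  refine ⟨sᶜ, hs_meas.compl, (prob_compl_eq_one_iff hs_meas).2 hs_zero, fun ω hω => ?_⟩
  by_contra hc
  exact hω (hs_sub hc)

end

end Paper
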